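/- For all n ≥ 1, P_n^σ(3i) ≠ 0 and P_n^σ(−3i) ≠ 0, where i is the imaginary unit in ℂ and P_n^σ are the D'Arcais polynomials. -/

import Mathlib

open Polynomial

/-- The polynomials `P_n^g ∈ ℚ[X]` defined by `P_0^g = 1` and
`P_n^g = (x/n) ∑_{k=1}^n g(k) P_{n-k}^g` for `n ≥ 1`. -/
noncomputable def darcais (g : ℕ → ℤ) : ℕ → ℚ[X]
  | 0 => 1
  | n + 1 =>
      C (((n : ℚ) + 1)⁻¹) * X *
        ∑ k ∈ Finset.range (n + 1), C ((g (k + 1) : ℚ)) * darcais g (n - k)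
  decreasing_by exact Nat.sub_lt_succ n k

/-- `A_n^g := n! ⬝ P_n^g`. -/
noncomputable def darcaisA (g : ℕ → ℤ) (n : ℕ) : ℚ[X] :=
  (n.factorial : ℚ[X]) * darcais g n

/-- Sum-of-divisors function `σ` as a `ℤ`-valued arithmetic function. -/
def sigma' (n : ℕ) : ℤ := ∑ d ∈ n.divisors, (d : ℤ)

/-- The integral polynomials `n! ⬝ P_n^g`, see `map_darcaisInt`. -/
noncomputable def darcaisInt (g : ℕ → ℤ) : ℕ → ℤ[X]
  | 0 => 1
  | n + 1 =>
      X * ∑ k ∈ Finset.range (n + 1), C (g (k + 1) * n.descFactorial k) * darcaisInt g (n - k)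
  decreasing_by exact Nat.sub_lt_succ n k

theorem darcaisInt_zero (g : ℕ → ℤ) : darcaisInt g 0 = 1 := by
  rw [darcaisInt]

theorem darcaisInt_succ (g : ℕ → ℤ) (n : ℕ) :
    darcaisInt g (n + 1) =
      X * ∑ k ∈ Finset.range (n + 1),
        C (g (k + 1) * n.descFactorial k) * darcaisInt g (n - k) := by
  rw [darcaisInt]

theorem map_darcaisInt (g : ℕ → ℤ) (n : ℕ) :
    (darcaisInt g n).map (Int.castRingHom ℚ) = darcaisA g n := by
  induction n using Nat.strong_induction_on with
  | _ n ih =>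
    cases n with
    | zero => simp [darcaisInt_zero, darcaisA, darcais]
    | succ n =>
      have h_cancel : ((n + 1 : ℕ) : ℚ[X]) * C (((n : ℚ) + 1)⁻¹) = 1 := by
        rw [← C_eq_natCast, ← C_mul, Nat.cast_succ, mul_inv_cancel₀ (by positivity), C_1]
      rw [darcaisInt_succ, darcaisA, darcais, Nat.factorial_succ, Nat.cast_mul]
      calc _ = X * ∑ k ∈ Finset.range (n + 1),
            (n.factorial : ℚ[X]) * (C (g (k + 1) : ℚ) * darcais g (n - k)) := by
            rw [Polynomial.map_mul, map_X, Polynomial.map_sum]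
            congr 1
            refine Finset.sum_congr rfl fun k hk => ?_
            have hkn : k ≤ n := Nat.lt_succ_iff.mp (Finset.mem_range.mp hk)
            rw [Polynomial.map_mul, Polynomial.map_C, ih (n - k) (by omega), darcaisA,
              ← Nat.factorial_mul_descFactorial hkn]
            simp only [map_mul, eq_intCast, Int.cast_natCast, Nat.cast_mul,
              C_eq_natCast]
            ring
        _ = _ := by
            rw [← Finset.mul_sum]
            linear_combination (-(X * (n.factorial : ℚ[X]) *
              ∑ k ∈ Finset.range (n + 1), C (g (k + 1) : ℚ) * darcais g (n - k))) * h_cancel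

theorem natCast_descFactorial_mul_add_modEq (p m b k : ℕ) :
    (p * m + b).descFactorial k ≡ b.descFactorial k [MOD p] := by
  induction k with
  | zero => simp [Nat.ModEq.refl]
  | succ k ih =>
    rw [Nat.descFactorial_succ, Nat.descFactorial_succ]
    rcases le_or_gt k b with hk | hk
    · refine Nat.ModEq.mul ?_ ih
      rw [Nat.add_sub_assoc hk]
      simp [Nat.ModEq]
    · rw [Nat.descFactorial_of_lt hk] at ih ⊢
      simpa using ih.mul_left (p * m + b - k)

/-- Modulo `p`, the recursion for `n! ⬝ P_n^g` only reaches back to the last multiple of `p`. -/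
theorem dvd_darcaisInt_mul_add_sub (g : ℕ → ℤ) (p m b : ℕ) :
    (p : ℤ[X]) ∣ darcaisInt g (p * m + b) - darcaisInt g (p * m) * darcaisInt g b := by
  induction b using Nat.strong_induction_on with
  | _ b ih =>
    cases b with
    | zero => simp [darcaisInt_zero]
    | succ b =>
      have h_tail : ∑ k ∈ Finset.range (b + 1),
            C (g (k + 1) * b.descFactorial k) * darcaisInt g (p * m + b - k) =
          ∑ k ∈ Finset.range (p * m + b + 1),
            C (g (k + 1) * b.descFactorial k) * darcaisInt g (p * m + b - k) := by
        refine Finset.sum_subset (Finset.range_mono (by omega)) fun k _ hk => ?_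
        rw [Nat.descFactorial_of_lt (by simpa using hk)]
        simp
      have h_left : (p : ℤ[X]) ∣
          ∑ k ∈ Finset.range (p * m + b + 1),
            C (g (k + 1) * (p * m + b).descFactorial k) * darcaisInt g (p * m + b - k) -
          ∑ k ∈ Finset.range (b + 1),
            C (g (k + 1) * b.descFactorial k) * darcaisInt g (p * m + b - k) := by
        rw [h_tail, ← Finset.sum_sub_distrib]
        refine Finset.dvd_sum fun k _ => ?_
        rw [← sub_mul, ← C_sub, ← mul_sub, ← C_eq_natCast]
        refine Dvd.dvd.mul_right (_root_.map_dvd C (Dvd.dvd.mul_left ?_ _)) _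
        exact (Nat.modEq_iff_dvd.mp (natCast_descFactorial_mul_add_modEq p m b k).symm)
      have h_right : (p : ℤ[X]) ∣
          ∑ k ∈ Finset.range (b + 1),
            C (g (k + 1) * b.descFactorial k) * darcaisInt g (p * m + b - k) -
          darcaisInt g (p * m) * ∑ k ∈ Finset.range (b + 1),
            C (g (k + 1) * b.descFactorial k) * darcaisInt g (b - k) := by
        rw [Finset.mul_sum, ← Finset.sum_sub_distrib]
        refine Finset.dvd_sum fun k hk => ?_
        have hkb : k ≤ b := Nat.lt_succ_iff.mp (Finset.mem_range.mp hk)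
        rw [Nat.add_sub_assoc hkb, mul_left_comm, ← mul_sub]
        exact (ih (b - k) (by omega)).mul_left _
      rw [← add_assoc, darcaisInt_succ, darcaisInt_succ, mul_left_comm, ← mul_sub]
      simpa using (dvd_add h_left h_right).mul_left X

/-- If `p` is prime in `R` and divides none of the first values `b! ⬝ P_b^g(w)`, `b ≤ p`, then it
divides none of them. -/
theorem not_dvd_aeval_darcaisInt {R : Type*} [CommRing R] (g : ℕ → ℤ) {p : ℕ} {w : R}
    (hp : Prime (p : R)) (hp0 : 0 < p)
    (h : ∀ b ≤ p, ¬ (p : R) ∣ aeval w (darcaisInt g b)) (n : ℕ) :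
    ¬ (p : R) ∣ aeval w (darcaisInt g n) := by
  have h_step (m b : ℕ) (hb : b ≤ p) (hm : ¬ (p : R) ∣ aeval w (darcaisInt g (p * m))) :
      ¬ (p : R) ∣ aeval w (darcaisInt g (p * m + b)) := by
    have h_dvd := _root_.map_dvd (aeval w) (dvd_darcaisInt_mul_add_sub g p m b)
    rw [map_sub, map_mul, map_natCast] at h_dvd
    rw [(dvd_iff_dvd_of_dvd_sub h_dvd), hp.dvd_mul, not_or]
    exact ⟨hm, h b hb⟩
  have h_mul (m : ℕ) : ¬ (p : R) ∣ aeval w (darcaisInt g (p * m)) := by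
    induction m with
    | zero => exact h 0 hp0.le
    | succ m ih => exact h_step m p le_rfl ih
  rw [← Nat.div_add_mod n p]
  exact h_step _ _ (Nat.mod_lt _ hp0).le (h_mul _)

theorem aeval_darcais_ne_zero (g : ℕ → ℤ) (w : GaussianInt) (n : ℕ)
    (h : aeval w (darcaisInt g n) ≠ 0) :
    aeval (GaussianInt.toComplex w) (darcais g n) ≠ 0 := by
  contrapose h
  have h_zero : aeval (GaussianInt.toComplex w) (darcaisA g n) = 0 := by
    rw [darcaisA, map_mul, h, mul_zero]
  rw [← map_darcaisInt, show Int.castRingHom ℚ = algebraMap ℤ ℚ from rfl,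
    aeval_map_algebraMap, ← GaussianInt.toComplex.toIntAlgHom_apply, aeval_algHom_apply] at h_zero
  exact GaussianInt.toComplex_eq_zero.mp h_zero

theorem not_seven_dvd_aeval_darcaisInt_sigma' {w : GaussianInt} (hw : w = ⟨0, 3⟩ ∨ w = ⟨0, -3⟩)
    (n : ℕ) : ¬ ((7 : ℕ) : GaussianInt) ∣ aeval w (darcaisInt sigma' n) := by
  refine not_dvd_aeval_darcaisInt _ ?_ (by norm_num) (fun b hb => ?_) n
  · have : Fact (Nat.Prime 7) := ⟨by norm_num⟩
    exact GaussianInt.prime_of_nat_prime_of_mod_four_eq_three 7 (by norm_num)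
  have hs : sigma' 1 = 1 ∧ sigma' 2 = 3 ∧ sigma' 3 = 4 ∧ sigma' 4 = 7 ∧ sigma' 5 = 6 ∧
      sigma' 6 = 12 ∧ sigma' 7 = 8 := by decide
  obtain ⟨h1, h2, h3, h4, h5, h6, h7⟩ := hs
  have a0 : aeval w (darcaisInt sigma' 0) = 1 := by simp [darcaisInt_zero]
  have h_succ (n : ℕ) : aeval w (darcaisInt sigma' (n + 1)) =
      w * ∑ k ∈ Finset.range (n + 1),
        ((sigma' (k + 1) * n.descFactorial k : ℤ) : GaussianInt) *
          aeval w (darcaisInt sigma' (n - k)) := by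
    simp [darcaisInt_succ]
  have a1 := h_succ 0
  have a2 := h_succ 1
  have a3 := h_succ 2
  have a4 := h_succ 3
  have a5 := h_succ 4
  have a6 := h_succ 5
  have a7 := h_succ 6
  simp [Finset.sum_range_succ, Nat.descFactorial, a0, h1, h2, h3, h4, h5, h6, h7]
    at a1 a2 a3 a4 a5 a6 a7
  rw [← Int.cast_natCast, Zsqrtd.intCast_dvd]
  rcases hw with rfl | rfl <;> interval_cases b <;>
    simp only [a0, a1, a2, a3, a4, a5, a6, a7] <;> decide

/-- For all `n ≥ 1`, `P_n^σ(3i) ≠ 0` and `P_n^σ(-3i) ≠ 0`. -/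
theorem darcaisSigma_ne_zero_at_three_I (n : ℕ) (hn : 1 ≤ n) :
    aeval (3 * Complex.I) (darcais sigma' n) ≠ 0 ∧
    aeval (-(3 * Complex.I)) (darcais sigma' n) ≠ 0 := by
  have h_ne {w : GaussianInt} (hw : w = ⟨0, 3⟩ ∨ w = ⟨0, -3⟩) :
      aeval (GaussianInt.toComplex w) (darcais sigma' n) ≠ 0 :=
    aeval_darcais_ne_zero _ _ _ fun h_zero =>
      not_seven_dvd_aeval_darcaisInt_sigma' hw n (h_zero ▸ dvd_zero _)
  have h_pos : GaussianInt.toComplex ⟨0, 3⟩ = 3 * Complex.I := by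
    rw [GaussianInt.toComplex_def']; simp
  have h_neg : GaussianInt.toComplex ⟨0, -3⟩ = -(3 * Complex.I) := by
    rw [GaussianInt.toComplex_def']; simp
  exact ⟨h_pos ▸ h_ne (Or.inl rfl), h_neg ▸ h_ne (Or.inr rfl)⟩
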